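/- Suppose the data augmentation transition density p defines a bounded linear operator P on the complex Hilbert space L²(π_U μ) via (Pf)(u) = ∫_{S_U} p(u,u′) f(u′) μ(du′). If there exists an orthonormal (Hilbert) basis {g_i}_{i∈ℕ} of L²(π_U μ) such that Σ_{i=0}^∞ ⟨P g_i, g_i⟩ < ∞, then ∫_{S_U} p(u,u) μ(du) < ∞, where p(u,u) = ∫_{S_V} π_{U,V}(u,v)²/(π_U(u)π_V(v)) ν(dv). -/

import Mathlib

open MeasureTheory

open scoped ENNReal ComplexConjugate

section MarkovDensity

variable {U V : Type*} [MeasurableSpace U] [MeasurableSpace V]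
  {m : Measure U} {n : Measure V}

lemma lintegral_mul_mul_density_left_le {κ : U → V → ℝ≥0∞}
    (hκ : Measurable (Function.uncurry κ))
    (h1 : ∀ᵐ u ∂m, ∫⁻ v, κ u v ∂n ≤ 1) (h2 : ∀ᵐ v ∂n, ∫⁻ u, κ u v ∂m ≤ 1)
    {a : U → ℝ≥0∞} :
    ∫⁻ u, ∫⁻ v, ∫⁻ u', a u * (κ u v * κ u' v) ∂m ∂n ∂m ≤ ∫⁻ u, a u ∂m := by
  refine lintegral_mono_ae ?_
  filter_upwards [h1] with u hu
  have hm : ∀ v, Measurable fun u' => κ u' v := fun v => hκ.of_uncurry_right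
  have hm' : Measurable fun v => κ u v := hκ.of_uncurry_left
  calc ∫⁻ v, ∫⁻ u', a u * (κ u v * κ u' v) ∂m ∂n
      = ∫⁻ v, a u * κ u v * ∫⁻ u', κ u' v ∂m ∂n := by
        refine lintegral_congr fun v => ?_
        rw [← lintegral_const_mul _ (hm v)]
        simp_rw [mul_assoc]
    _ ≤ ∫⁻ v, a u * κ u v ∂n := by
        refine lintegral_mono_ae ?_
        filter_upwards [h2] with v hv
        exact mul_le_of_le_one_right' hv
    _ = a u * ∫⁻ v, κ u v ∂n := lintegral_const_mul _ hm'
    _ ≤ a u := mul_le_of_le_one_right' hu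

lemma lintegral_mul_mul_density_right_le [SFinite m] [SFinite n] {κ : U → V → ℝ≥0∞}
    (hκ : Measurable (Function.uncurry κ))
    (h1 : ∀ᵐ u ∂m, ∫⁻ v, κ u v ∂n ≤ 1) (h2 : ∀ᵐ v ∂n, ∫⁻ u, κ u v ∂m ≤ 1)
    {a : U → ℝ≥0∞} (ha : Measurable a) :
    ∫⁻ u, ∫⁻ v, ∫⁻ u', a u' * (κ u v * κ u' v) ∂m ∂n ∂m ≤ ∫⁻ u, a u ∂m := by
  have hsw : ∫⁻ u, ∫⁻ v, ∫⁻ u', a u' * (κ u v * κ u' v) ∂m ∂n ∂m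
      = ∫⁻ u', ∫⁻ v, ∫⁻ u, a u' * (κ u v * κ u' v) ∂m ∂n ∂m := by
    rw [lintegral_lintegral_swap (by fun_prop)]
    rw [lintegral_lintegral_swap (μ := m) (ν := n) (by fun_prop)]
    exact lintegral_congr fun v => lintegral_lintegral_swap (by fun_prop)
  rw [hsw]
  simp_rw [fun u v u' => mul_comm (κ u v) (κ u' v)]
  exact lintegral_mul_mul_density_left_le hκ h1 h2

lemma integrable_conj_mul_mul_density [SFinite m] [SFinite n] {k : U → V → ℝ}
    (hk : Measurable (Function.uncurry k))
    (h1 : ∀ᵐ u ∂m, ∫⁻ v, ‖k u v‖ₑ ∂n ≤ 1) (h2 : ∀ᵐ v ∂n, ∫⁻ u, ‖k u v‖ₑ ∂m ≤ 1)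
    {f : U → ℂ} (hf : Measurable f) (hf2 : MemLp f 2 m) :
    Integrable (fun z : U × V × U =>
      conj (f z.1) * f z.2.2 * (k z.1 z.2.1 * k z.2.2 z.2.1 : ℂ)) (m.prod (n.prod m)) := by
  have hfin : ∫⁻ u, ‖f u‖ₑ ^ 2 ∂m < ∞ := by
    have := hf2.eLpNorm_lt_top
    rw [eLpNorm_lt_top_iff_lintegral_rpow_enorm_lt_top (by simp) (by simp)] at this
    simpa using this
  have hκ : Measurable (Function.uncurry fun u v => ‖k u v‖ₑ) := hk.enorm
  have amgm : ∀ x y : ℝ≥0∞, x * y ≤ x ^ 2 + y ^ 2 := by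
    intro x y
    rcases le_total x y with h | h
    · calc x * y ≤ y * y := by gcongr
        _ = y ^ 2 := by ring
        _ ≤ _ := le_add_self
    · calc x * y ≤ x * x := by gcongr
        _ = x ^ 2 := by ring
        _ ≤ _ := le_self_add
  have hFm : Measurable (fun z : U × V × U =>
      conj (f z.1) * f z.2.2 * (k z.1 z.2.1 * k z.2.2 z.2.1 : ℂ)) := by fun_prop
  refine ⟨hFm.aestronglyMeasurable, ?_⟩
  rw [hasFiniteIntegral_iff_enorm, lintegral_prod _ hFm.enorm.aemeasurable]
  simp_rw [fun u => lintegral_prod (μ := n) (ν := m) (fun z : V × U =>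
      ‖conj (f u) * f z.2 * (k u z.1 * k z.2 z.1 : ℂ)‖ₑ)
    (hFm.comp measurable_prodMk_left).enorm.aemeasurable]
  calc _ ≤ ∫⁻ u, ∫⁻ v, ∫⁻ u', (‖f u‖ₑ ^ 2 * (‖k u v‖ₑ * ‖k u' v‖ₑ)
            + ‖f u'‖ₑ ^ 2 * (‖k u v‖ₑ * ‖k u' v‖ₑ)) ∂m ∂n ∂m := by
        gcongr with u v u'
        rw [← add_mul]
        simp only [enorm_mul, RCLike.enorm_conj]
        have hr : ∀ x : ℝ, ‖(x : ℂ)‖ₑ = ‖x‖ₑ := fun x => by simp [enorm_eq_nnnorm]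
        rw [hr, hr]
        gcongr
        exact amgm _ _
    _ = ∫⁻ u, ∫⁻ v, ∫⁻ u', ‖f u‖ₑ ^ 2 * (‖k u v‖ₑ * ‖k u' v‖ₑ) ∂m ∂n ∂m
        + ∫⁻ u, ∫⁻ v, ∫⁻ u', ‖f u'‖ₑ ^ 2 * (‖k u v‖ₑ * ‖k u' v‖ₑ) ∂m ∂n ∂m := by
        rw [← lintegral_add_left (by fun_prop)]
        refine lintegral_congr fun u => ?_
        rw [← lintegral_add_left (by fun_prop)]
        refine lintegral_congr fun v => ?_
        rw [← lintegral_add_left (by fun_prop)]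
    _ ≤ ∫⁻ u, ‖f u‖ₑ ^ 2 ∂m + ∫⁻ u, ‖f u‖ₑ ^ 2 ∂m :=
        add_le_add (lintegral_mul_mul_density_left_le hκ h1 h2)
          (lintegral_mul_mul_density_right_le hκ h1 h2 (by fun_prop))
    _ < ∞ := ENNReal.add_lt_top.2 ⟨hfin, hfin⟩

lemma integral_conj_mul_eq_integral_norm_sq [SFinite m] [SFinite n] {k : U → V → ℝ}
    (hk : Measurable (Function.uncurry k))
    (h1 : ∀ᵐ u ∂m, ∫⁻ v, ‖k u v‖ₑ ∂n ≤ 1) (h2 : ∀ᵐ v ∂n, ∫⁻ u, ‖k u v‖ₑ ∂m ≤ 1)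
    {f : U → ℂ} (hf : Measurable f) (hf2 : MemLp f 2 m) :
    Integrable (fun v => ‖∫ u, k u v * f u ∂m‖ ^ 2) n ∧
    ∫ u, conj (f u) * ∫ u', ((∫ v, k u v * k u' v ∂n : ℝ) : ℂ) * f u' ∂m ∂m
      = (∫ v, ‖∫ u, k u v * f u ∂m‖ ^ 2 ∂n : ℝ) := by
  have hF := integrable_conj_mul_mul_density hk h1 h2 hf hf2
  set q : V → ℂ := fun v => ∫ u, k u v * f u ∂m with hq
  have hin : ∀ u v, ∫ u', conj (f u) * f u' * (k u v * k u' v : ℂ) ∂m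
      = conj (f u) * k u v * q v := by
    intro u v
    rw [hq, ← integral_const_mul]
    exact integral_congr_ae (.of_forall fun u' => by ring)
  have hout : ∀ v, ∫ u, conj (f u) * k u v * q v ∂m = ((‖q v‖ ^ 2 : ℝ) : ℂ) := by
    intro v
    rw [integral_mul_const, Complex.ofReal_pow, ← Complex.conj_mul']
    congr 1
    rw [hq, ← integral_conj]
    exact integral_congr_ae (.of_forall fun u => by simp [mul_comm])
  have hG : Integrable (fun z : U × V => conj (f z.1) * k z.1 z.2 * q z.2) (m.prod n) := by
    have := ((measurePreserving_prodAssoc m n m).integrable_comp_emb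
      MeasurableEquiv.prodAssoc.measurableEmbedding).2 hF
    refine this.integral_prod_left.congr (.of_forall fun z => ?_)
    exact hin z.1 z.2
  constructor
  · have := hG.swap.integral_prod_left
    refine (this.congr (.of_forall fun v => hout v)).re.congr (.of_forall fun v => ?_)
    exact Complex.ofReal_re _
  · calc _ = ∫ u, ∫ v, conj (f u) * k u v * q v ∂n ∂m := by
          refine integral_congr_ae ?_
          filter_upwards [hF.prod_right_ae] with u hu
          have hu' := integral_integral_swap (f := fun v u' =>
            conj (f u) * f u' * (k u v * k u' v : ℂ)) hu
          simp_rw [hin] at hu'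
          rw [hu', ← integral_const_mul]
          refine integral_congr_ae (.of_forall fun u' => ?_)
          simp only
          rw [← integral_complex_ofReal, ← integral_mul_const, ← integral_const_mul]
          refine integral_congr_ae (.of_forall fun v => ?_)
          push_cast
          ring
      _ = ∫ v, ∫ u, conj (f u) * k u v * q v ∂m ∂n := integral_integral_swap hG
      _ = _ := by simp_rw [hout]; exact integral_ofReal

lemma ae_eq_of_forall_setIntegral_rectangle_eq [IsFiniteMeasure m] [IsFiniteMeasure n]
    {E : Type*} [NormedAddCommGroup E] [NormedSpace ℝ E] [CompleteSpace E]
    {f g : U × V → E} (hf : Integrable f (m.prod n)) (hg : Integrable g (m.prod n))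
    (h : ∀ A B, MeasurableSet A → MeasurableSet B →
      ∫ z in A ×ˢ B, f z ∂(m.prod n) = ∫ z in A ×ˢ B, g z ∂(m.prod n)) :
    f =ᵐ[m.prod n] g := by
  refine hf.ae_eq_of_forall_setIntegral_eq _ _ hg fun s hs _ => ?_
  have huniv : ∫ z, f z ∂(m.prod n) = ∫ z, g z ∂(m.prod n) := by
    simpa using h _ _ MeasurableSet.univ MeasurableSet.univ
  induction s, hs using MeasurableSpace.induction_on_inter generateFrom_prod.symm isPiSystem_prod with
  | empty => simp
  | basic t ht =>
    obtain ⟨A, hA, B, hB, rfl⟩ := ht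
    exact h A B hA hB
  | compl t ht ih =>
    have h1 := integral_add_compl ht hf
    have h2 := integral_add_compl ht hg
    rw [ih (measure_lt_top _ _), huniv, ← h2] at h1
    exact add_left_cancel h1
  | iUnion t hd ht ih =>
    rw [integral_iUnion ht hd hf.integrableOn, integral_iUnion ht hd hg.integrableOn]
    exact tsum_congr fun i => ih i (measure_lt_top _ _)

lemma summable_of_pairwise_orthogonal {H : Type*} [NormedAddCommGroup H] [InnerProductSpace ℂ H]
    [CompleteSpace H] {ι : Type*} {t : ι → H} (ht : Pairwise fun i j => inner ℂ (t i) (t j) = 0)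
    (hs : Summable fun i => ‖t i‖ ^ 2) : Summable t := by
  have hV : OrthogonalFamily ℂ (fun i => Submodule.span ℂ {t i})
      fun i => (Submodule.span ℂ {t i}).subtypeₗᵢ := by
    refine OrthogonalFamily.of_pairwise fun i j hij => ?_
    refine Submodule.isOrtho_span.2 ?_
    rintro _ rfl _ rfl
    exact ht hij
  exact (hV.summable_iff_norm_sq_summable fun i =>
    ⟨t i, Submodule.mem_span_singleton_self _⟩).2 hs

lemma integrable_density_mul [SFinite m] [SFinite n] {k : U → V → ℝ}
    (hk : Measurable (Function.uncurry k)) (h1 : ∀ᵐ u ∂m, ∫⁻ v, ‖k u v‖ₑ ∂n ≤ 1)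
    {f : U → ℂ} (hf : Measurable f) (hfi : Integrable f m) :
    Integrable (fun z : U × V => (k z.1 z.2 : ℂ) * f z.1) (m.prod n) := by
  have hm : Measurable (fun z : U × V => (k z.1 z.2 : ℂ) * f z.1) := by fun_prop
  refine ⟨hm.aestronglyMeasurable, ?_⟩
  rw [hasFiniteIntegral_iff_enorm, lintegral_prod _ hm.enorm.aemeasurable]
  refine lt_of_le_of_lt (lintegral_mono_ae ?_) (hasFiniteIntegral_iff_enorm.1 hfi.2)
  filter_upwards [h1] with u hu
  have hku : Measurable (k u) := hk.of_uncurry_left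
  simp only [enorm_mul]
  rw [lintegral_mul_const _ (by fun_prop)]
  refine mul_le_of_le_one_left' ?_
  simpa [enorm_eq_nnnorm] using hu

lemma lintegral_enorm_density_sq_lt_top [IsFiniteMeasure m] [IsFiniteMeasure n] {k : U → V → ℝ}
    (hk : Measurable (Function.uncurry k))
    (h1 : ∀ᵐ u ∂m, ∫⁻ v, ‖k u v‖ₑ ∂n ≤ 1) (h2 : ∀ᵐ v ∂n, ∫⁻ u, ‖k u v‖ₑ ∂m ≤ 1)
    (g : HilbertBasis ℕ ℂ (Lp ℂ 2 m))
    (hs : Summable fun i => ∫ v, ‖∫ u, k u v * g i u ∂m‖ ^ 2 ∂n) :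
    ∫⁻ z, ‖k z.1 z.2‖ₑ ^ 2 ∂(m.prod n) < ∞ := by
  have hgm : ∀ i, Measurable (g i) := fun i => (Lp.stronglyMeasurable (g i)).measurable
  have hg2 : ∀ i, MemLp (g i) 2 m := fun i => Lp.memLp (g i)
  set q : ℕ → V → ℂ := fun i v => ∫ u, k u v * g i u ∂m with hq
  have hqm : ∀ i, StronglyMeasurable (q i) := fun i =>
    StronglyMeasurable.integral_prod_left (f := fun u v => (k u v : ℂ) * g i u)
      (Measurable.stronglyMeasurable (by fun_prop))
  have hqsq : ∀ i, Integrable (fun v => ‖q i v‖ ^ 2) n := fun i =>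
    (integral_conj_mul_eq_integral_norm_sq hk h1 h2 (hgm i) (hg2 i)).1
  -- The Hilbert-Schmidt expansion of the kernel.
  set T : ℕ → U × V → ℂ := fun i z => conj (g i z.1) * q i z.2 with hT
  have hTm : ∀ i, Measurable (T i) := fun i => by
    have := (hqm i).measurable
    fun_prop
  have hT2 : ∀ i, MemLp (T i) 2 (m.prod n) := fun i => by
    rw [memLp_two_iff_integrable_sq_norm (hTm i).aestronglyMeasurable]
    simp only [hT, norm_mul, mul_pow, RCLike.norm_conj]
    exact ((memLp_two_iff_integrable_sq_norm (hgm i).aestronglyMeasurable).1 (hg2 i)).mul_prod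
      (hqsq i)
  have hinner : ∀ i j, inner ℂ ((hT2 i).toLp) ((hT2 j).toLp)
      = inner ℂ (g j) (g i) * ∫ v, conj (q i v) * q j v ∂n := by
    intro i j
    rw [L2.inner_def, L2.inner_def, ← integral_prod_mul]
    refine integral_congr_ae ?_
    filter_upwards [(hT2 i).coeFn_toLp, (hT2 j).coeFn_toLp] with z hi hj
    rw [hi, hj]
    simp only [hT, RCLike.inner_apply, map_mul, RCLike.conj_conj]
    ring
  have hsum : Summable fun i => (hT2 i).toLp := by
    refine summable_of_pairwise_orthogonal (fun i j hij => ?_) (hs.congr fun i => ?_)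
    · change inner ℂ ((hT2 i).toLp) ((hT2 j).toLp) = 0
      rw [hinner, g.orthonormal.2 hij.symm, zero_mul]
    · have h := hinner i i
      rw [inner_self_eq_norm_sq_to_K, inner_self_eq_norm_sq_to_K, g.orthonormal.1 i] at h
      simp_rw [Complex.conj_mul', ← Complex.ofReal_pow, integral_complex_ofReal] at h
      rw [RCLike.ofReal_one, one_pow, one_mul] at h
      exact (Complex.ofReal_injective (by rw [← h]; norm_cast)).symm
  set K := ∑' i, (hT2 i).toLp
  have hkint : Integrable (fun z : U × V => (k z.1 z.2 : ℂ)) (m.prod n) := by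
    simpa using integrable_density_mul hk h1 measurable_const (integrable_const (1 : ℂ))
  have hrect : ∀ A B, MeasurableSet A → MeasurableSet B →
      ∫ z in A ×ˢ B, (k z.1 z.2 : ℂ) ∂(m.prod n) = ∫ z in A ×ˢ B, K z ∂(m.prod n) := by
    intro A B hA hB
    set b : U → ℂ := fun u => ∫ v in B, (k u v : ℂ) ∂n with hb
    have hbm : StronglyMeasurable b :=
      StronglyMeasurable.integral_prod_right (f := fun u v => (k u v : ℂ))
        (Measurable.stronglyMeasurable (by fun_prop))
    have hb2 : MemLp b 2 m := by
      refine MemLp.of_bound hbm.aestronglyMeasurable 1 ?_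
      filter_upwards [h1] with u hu
      have hle : ‖b u‖ₑ ≤ ‖(1 : ℝ)‖ₑ := by
        calc ‖b u‖ₑ ≤ ∫⁻ v in B, ‖(k u v : ℂ)‖ₑ ∂n := enorm_integral_le_lintegral_enorm _
          _ ≤ ∫⁻ v, ‖(k u v : ℂ)‖ₑ ∂n := setLIntegral_le_lintegral _ _
          _ ≤ ‖(1 : ℝ)‖ₑ := by simpa [enorm_eq_nnnorm] using hu
      simpa using enorm_le_iff_norm_le.1 hle
    have hbreal : ∀ u, conj (b u) = b u := fun u => by
      simp only [hb]
      rw [integral_complex_ofReal, Complex.conj_ofReal]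
    have hterm : ∀ i, ∫ z in A ×ˢ B, T i z ∂(m.prod n)
        = inner ℂ hb2.toLp (g i) * inner ℂ (g i) (indicatorConstLp 2 hA (measure_ne_top m A) 1) := by
      intro i
      have hgA : inner ℂ (g i) (indicatorConstLp 2 hA (measure_ne_top m A) 1)
          = ∫ u in A, conj (g i u) ∂m := by
        rw [← inner_conj_symm, L2.inner_indicatorConstLp_one, ← integral_conj]
      have hgB : inner ℂ hb2.toLp (g i) = ∫ v in B, q i v ∂n := by
        have hsw := integral_integral_swap (f := fun u v => (k u v : ℂ) * g i u)
          (integrable_density_mul (n := n.restrict B) hk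
            (h1.mono fun u hu => (lintegral_mono' Measure.restrict_le_self le_rfl).trans hu)
            (hgm i) ((hg2 i).integrable (by norm_num)))
        rw [hq, ← hsw, L2.inner_def]
        refine integral_congr_ae ?_
        filter_upwards [hb2.coeFn_toLp] with u hu
        rw [hu, RCLike.inner_apply, hbreal, hb, integral_mul_const, mul_comm]
      rw [hgA, hgB, mul_comm, ← setIntegral_prod_mul]
    have hl := (g.hasSum_inner_mul_inner hb2.toLp
      (indicatorConstLp 2 hA (measure_ne_top m A) 1))
    have hr := hsum.hasSum.mapL
      (innerSL ℂ (indicatorConstLp 2 (hA.prod hB) (measure_ne_top (m.prod n) _) (1 : ℂ)))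
    simp only [innerSL_apply_apply, L2.inner_indicatorConstLp_one] at hr
    have hTi : ∀ i, ∫ z in A ×ˢ B, ((hT2 i).toLp (T i)) z ∂(m.prod n)
        = ∫ z in A ×ˢ B, T i z ∂(m.prod n) := fun i =>
      integral_congr_ae (ae_restrict_of_ae (hT2 i).coeFn_toLp)
    simp_rw [hTi, hterm] at hr
    rw [hr.unique hl, ← inner_conj_symm, L2.inner_indicatorConstLp_one,
      setIntegral_prod _ hkint.integrableOn, ← integral_conj]
    refine integral_congr_ae (ae_restrict_of_ae ?_)
    filter_upwards [hb2.coeFn_toLp] with u hu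
    rw [hu, hbreal]
  have hae := ae_eq_of_forall_setIntegral_rectangle_eq hkint ((Lp.memLp K).integrable (by norm_num))
    hrect
  have hfin := (Lp.memLp K).eLpNorm_lt_top
  rw [← eLpNorm_congr_ae hae, eLpNorm_lt_top_iff_lintegral_rpow_enorm_lt_top (by simp) (by simp)]
    at hfin
  simpa [enorm_eq_nnnorm] using hfin

lemma lintegral_enorm_div_mul_withDensity_le_one {a w : V → ℝ} (ha : Integrable a n)
    (ham : Measurable a) (ha0 : ∀ v, 0 ≤ a v) (hw : Measurable w) (hw0 : ∀ v, 0 ≤ w v) :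
    ∫⁻ v, ‖a v / ((∫ v', a v' ∂n) * w v)‖ₑ ∂(n.withDensity fun v => ENNReal.ofReal (w v)) ≤ 1 := by
  set c := ∫ v', a v' ∂n with hc
  have hc0 : 0 ≤ c := integral_nonneg ha0
  rw [lintegral_withDensity_eq_lintegral_mul _ (by fun_prop) (by fun_prop)]
  calc _ ≤ ∫⁻ v, ENNReal.ofReal c⁻¹ * ENNReal.ofReal (a v) ∂n := by
        refine lintegral_mono fun v => ?_
        have h0 : 0 ≤ a v / (c * w v) := div_nonneg (ha0 v) (mul_nonneg hc0 (hw0 v))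
        rw [Pi.mul_apply, Real.enorm_of_nonneg h0, ← ENNReal.ofReal_mul (hw0 v),
          ← ENNReal.ofReal_mul (inv_nonneg.2 hc0)]
        refine ENNReal.ofReal_le_ofReal ?_
        rcases (hw0 v).eq_or_lt' with h | h
        · rw [h, zero_mul]
          exact mul_nonneg (inv_nonneg.2 hc0) (ha0 v)
        · rw [div_mul_eq_div_div, mul_div_cancel₀ _ h.ne', div_eq_inv_mul]
    _ = ENNReal.ofReal c⁻¹ * ENNReal.ofReal c := by
        rw [lintegral_const_mul _ (by fun_prop),
          ← ofReal_integral_eq_lintegral_ofReal ha (.of_forall ha0)]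
    _ ≤ 1 := by
        rw [← ENNReal.ofReal_mul (inv_nonneg.2 hc0), ← ENNReal.ofReal_one]
        exact ENNReal.ofReal_le_ofReal inv_mul_le_one

end MarkovDensity



/-- Suppose the data augmentation transition density `p` defines a
bounded linear operator `P` on `L²(π_U μ)` via `(Pf)(u) = ∫ p(u,u') f(u') μ(du')`.
If there is an orthonormal Hilbert basis `g` of `L²(π_U μ)` such that
`∑ᵢ ⟨P gᵢ, gᵢ⟩ < ∞`, then `∫ p(u,u) μ(du) < ∞`. -/
theorem summable_trace_implies_integrable_diagonal
    {SU SV : Type*} [MeasurableSpace SU] [MeasurableSpace SV]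
    [MeasurableSpace.CountablyGenerated SU] [MeasurableSpace.CountablyGenerated SV]
    (μ : Measure SU) (ν : Measure SV) [SigmaFinite μ] [SigmaFinite ν]
    (piUV : SU → SV → ℝ)
    (hmeas : Measurable (Function.uncurry piUV))
    (hnn : ∀ u v, 0 ≤ piUV u v)
    (hprob : ∫⁻ q, ENNReal.ofReal (piUV q.1 q.2) ∂(μ.prod ν) = 1)
    (piU : SU → ℝ) (hpiU : ∀ u, piU u = ∫ v, piUV u v ∂ν)
    (piV : SV → ℝ) (hpiV : ∀ v, piV v = ∫ u, piUV u v ∂μ)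
    (hUpos : ∀ᵐ u ∂μ, 0 < piU u)
    (hVpos : ∀ᵐ v ∂ν, 0 < piV v)
    (p : SU → SU → ℝ)
    (hp : ∀ u u', p u u' = ∫ v, (piUV u' v / piV v) * (piUV u v / piU u) ∂ν)
    (P : Lp ℂ 2 (μ.withDensity fun u => ENNReal.ofReal (piU u)) →L[ℂ]
         Lp ℂ 2 (μ.withDensity fun u => ENNReal.ofReal (piU u)))
    (hP : ∀ f : Lp ℂ 2 (μ.withDensity fun u => ENNReal.ofReal (piU u)),
      ∀ᵐ u ∂μ, (P f) u = ∫ u', (p u u' : ℂ) * f u' ∂μ)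
    (g : HilbertBasis ℕ ℂ (Lp ℂ 2 (μ.withDensity fun u => ENNReal.ofReal (piU u))))
    (hsum : Summable fun i => inner (𝕜 := ℂ) (g i) (P (g i))) :
    ∫⁻ u, ENNReal.ofReal (p u u) ∂μ < ⊤ := by
  have hint : Integrable (Function.uncurry piUV) (μ.prod ν) := by
    refine ⟨hmeas.aestronglyMeasurable, ?_⟩
    rw [hasFiniteIntegral_iff_ofReal (.of_forall fun z : SU × SV => hnn z.1 z.2 :
      0 ≤ᵐ[_] Function.uncurry piUV)]
    exact hprob.trans_lt ENNReal.one_lt_top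
  have hUeq : piU = fun u => ∫ v, piUV u v ∂ν := funext hpiU
  have hVeq : piV = fun v => ∫ u, piUV u v ∂μ := funext hpiV
  have hU0 : ∀ u, 0 ≤ piU u := fun u => hpiU u ▸ integral_nonneg (hnn u)
  have hV0 : ∀ v, 0 ≤ piV v := fun v => hpiV v ▸ integral_nonneg fun u => hnn u v
  have hUm : Measurable piU := hUeq ▸ (hmeas.stronglyMeasurable.integral_prod_right).measurable
  have hVm : Measurable piV := hVeq ▸ (hmeas.stronglyMeasurable.integral_prod_left).measurable
  have hUi : Integrable piU μ := hUeq ▸ hint.integral_prod_left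
  have hVi : Integrable piV ν := hVeq ▸ hint.integral_prod_right
  generalize hm : μ.withDensity (fun u => ENNReal.ofReal (piU u)) = m at P hP g hsum
  set n := ν.withDensity fun v => ENNReal.ofReal (piV v) with hn
  have : IsFiniteMeasure m := hm ▸ isFiniteMeasure_withDensity_ofReal hUi.2
  have : IsFiniteMeasure n := isFiniteMeasure_withDensity_ofReal hVi.2
  have hmint : ∀ F : SU → ℂ, ∫ u, F u ∂m = ∫ u, (ENNReal.ofReal (piU u)).toReal • F u ∂μ :=
    fun F => by
      rw [← hm, integral_withDensity_eq_integral_toReal_smul (by fun_prop) (by simp)]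
  have hmac : ∀ {q : SU → Prop}, (∀ᵐ u ∂μ, q u) → ∀ᵐ u ∂m, q u :=
    fun h => hm ▸ (withDensity_absolutelyContinuous μ _).ae_le h
  have hnac : ∀ {q : SV → Prop}, (∀ᵐ v ∂ν, q v) → ∀ᵐ v ∂n, q v :=
    fun h => (withDensity_absolutelyContinuous ν _).ae_le h
  set k : SU → SV → ℝ := fun u v => piUV u v / (piU u * piV v) with hk
  have hkm : Measurable (Function.uncurry k) := by
    change Measurable fun z : SU × SV => piUV z.1 z.2 / (piU z.1 * piV z.2)
    fun_prop
  have h1 : ∀ᵐ u ∂m, ∫⁻ v, ‖k u v‖ₑ ∂n ≤ 1 := by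
    refine hmac ?_
    filter_upwards [hint.prod_right_ae] with u hu
    have := lintegral_enorm_div_mul_withDensity_le_one hu hmeas.of_uncurry_left (hnn u) hVm hV0
    simp only [Function.uncurry_apply_pair, ← hpiU, ← hn] at this
    exact this
  have h2 : ∀ᵐ v ∂n, ∫⁻ u, ‖k u v‖ₑ ∂m ≤ 1 := by
    refine hnac ?_
    filter_upwards [hint.prod_left_ae] with v hv
    have := lintegral_enorm_div_mul_withDensity_le_one hv hmeas.of_uncurry_right
      (fun u => hnn u v) hUm hU0
    simp only [Function.uncurry_apply_pair, ← hpiV, hm, mul_comm (piV v)] at this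
    exact this
  have hpk : ∀ u, 0 < piU u → ∀ u', 0 < piU u' →
      p u u' = piU u' * ∫ v, k u v * k u' v ∂n := by
    intro u hu u' hu'
    rw [hp, hn, integral_withDensity_eq_integral_toReal_smul (by fun_prop) (by simp),
      ← integral_const_mul]
    refine integral_congr_ae ?_
    filter_upwards [hVpos] with v hv
    simp only [hk, ENNReal.toReal_ofReal (hV0 v), smul_eq_mul]
    field_simp
  have hPk : ∀ f : Lp ℂ 2 m, ∀ᵐ u ∂m,
      (P f) u = ∫ u', ((∫ v, k u v * k u' v ∂n : ℝ) : ℂ) * f u' ∂m := by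
    intro f
    refine hmac ?_
    filter_upwards [hP f, hUpos] with u hu hpos
    rw [hu]
    rw [hmint]
    refine integral_congr_ae ?_
    filter_upwards [hUpos] with u' hpos'
    rw [hpk u hpos u' hpos', ENNReal.toReal_ofReal (hU0 u'), Complex.real_smul, Complex.ofReal_mul,
      mul_assoc]
  have htrace : ∀ i, inner ℂ (g i) (P (g i))
      = ((∫ v, ‖∫ u, k u v * g i u ∂m‖ ^ 2 ∂n : ℝ) : ℂ) := by
    intro i
    rw [← (integral_conj_mul_eq_integral_norm_sq hkm h1 h2 (Lp.stronglyMeasurable (g i)).measurable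
      (Lp.memLp (g i))).2, L2.inner_def]
    refine integral_congr_ae ?_
    filter_upwards [hPk (g i)] with u hu
    rw [hu, RCLike.inner_apply, mul_comm]
  have hfin := lintegral_enorm_density_sq_lt_top hkm h1 h2 g
    (Complex.summable_ofReal.1 (hsum.congr htrace))
  refine lt_of_le_of_lt ?_ hfin
  rw [lintegral_prod _ (by fun_prop), ← hm,
    lintegral_withDensity_eq_lintegral_mul _ (by fun_prop) (by fun_prop)]
  refine lintegral_mono_ae ?_
  filter_upwards [hUpos] with u hu
  have hku : Measurable (k u) := hkm.of_uncurry_left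
  rw [Pi.mul_apply, hn, lintegral_withDensity_eq_lintegral_mul _ (by fun_prop) (by fun_prop),
    ← lintegral_const_mul _ (by fun_prop), hp]
  have hnonneg : ∀ v, 0 ≤ piUV u v / piV v * (piUV u v / piU u) := fun v =>
    mul_nonneg (div_nonneg (hnn u v) (hV0 v)) (div_nonneg (hnn u v) (hU0 u))
  rw [← Real.enorm_of_nonneg (integral_nonneg hnonneg)]
  refine (enorm_integral_le_lintegral_enorm _).trans (lintegral_mono_ae ?_)
  filter_upwards [hVpos] with v hv
  have hkn : 0 ≤ k u v := div_nonneg (hnn u v) (mul_nonneg (hU0 u) (hV0 v))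
  rw [Pi.mul_apply, Real.enorm_of_nonneg (hnonneg v), Real.enorm_of_nonneg hkn,
    ← ENNReal.ofReal_pow hkn, ← ENNReal.ofReal_mul (hV0 v), ← ENNReal.ofReal_mul (hU0 u)]
  refine ENNReal.ofReal_le_ofReal (le_of_eq ?_)
  simp only [hk]
  field_simp
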